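/- arXiv:1705.01400 — 4 statements merged into one kernel-verified Lean document; each statement's English description precedes it below -/
import Mathlib

section
/- Let n be a positive integer, let X₁, …, Xₙ be nonempty sets, and let Z be a commutative group written multiplicatively. For a map f : X₁ × ⋯ × Xₙ → Z the following are equivalent: (1) f factorizes through the coordinates; (2) for every index k with 1 ≤ k ≤ n and all tuples x = (x₁,…,xₙ) and x' = (x'₁,…,x'ₙ) with xⱼ, x'ⱼ ∈ Xⱼ, the swap condition at index k holds for the pair x, x'. -/
/-- A map satisfying all swap conditions is determined on the tuples that agree with a base point
`a` off a finite set `s` by its values on the single-coordinate changes of `a`. -/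
theorem apply_piecewise_eq_mul_prod_of_swap {ι : Type*} [DecidableEq ι] {X : ι → Type*}
    {Z : Type*} [CommGroup Z] {f : (∀ i, X i) → Z}
    (h : ∀ (k : ι) (x x' : ∀ i, X i), f x * f x' =
      f (Function.update x k (x' k)) * f (Function.update x' k (x k)))
    (a x : ∀ i, X i) (s : Finset ι) :
    f (s.piecewise x a) = f a * ∏ i ∈ s, (f (Function.update a i (x i)) / f a) := by
  induction s using Finset.induction_on with
  | empty => simp
  | insert k s hk ih =>
    have swap := h k (s.piecewise x a) (Function.update a k (x k))
    simp only [Function.update_self, Finset.piecewise_eq_of_notMem _ _ _ hk,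
      Function.update_idem, Function.update_eq_self] at swap
    rw [Finset.piecewise_insert, Finset.prod_insert hk, mul_left_comm, ← ih,
      eq_div_of_mul_eq' swap.symm, mul_comm, div_mul_eq_mul_div]

/-- For nonempty sets `X 0, …, X (n-1)` and a commutative group `Z`,
a map `f : Π i, X i → Z` factorizes through the coordinates if and only if for every
index `k` and every pair of tuples `x, x'` the swap condition at index `k` holds. -/
theorem factorization_multi_variables {n : ℕ} (hn : 0 < n) {X : Fin n → Type*}
    [∀ i, Nonempty (X i)] {Z : Type*} [CommGroup Z] (f : (∀ i, X i) → Z) :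
    (∃ F : ∀ i, X i → Z, ∀ x : ∀ i, X i, f x = ∏ i, F i (x i)) ↔
    (∀ (k : Fin n) (x x' : ∀ i, X i),
      f x * f x' =
        f (Function.update x k (x' k)) * f (Function.update x' k (x k))) := by
  constructor
  · rintro ⟨F, hF⟩ k x x'
    simp only [hF, ← Finset.prod_mul_distrib]
    refine Finset.prod_congr rfl fun i _ => ?_
    obtain rfl | hik := eq_or_ne i k
    · simp [mul_comm]
    · simp [hik]
  · intro h
    let a : ∀ i, X i := fun i => Classical.arbitrary (X i)
    refine ⟨fun i y => (if i = ⟨0, hn⟩ then f a else 1) * (f (Function.update a i y) / f a),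
      fun x => ?_⟩
    have key := apply_piecewise_eq_mul_prod_of_swap h a x Finset.univ
    rw [Finset.piecewise_univ] at key
    rw [key, Finset.prod_mul_distrib, Finset.prod_ite_eq' Finset.univ, if_pos (Finset.mem_univ _)]
end

section
/- Let Σ be a nonempty finite set, let S be a finite set with at least 3 elements, and let Z be a commutative group written multiplicatively. Let P : (Σ → S) → Z, and suppose there exists an element p ∈ Z with the following property: for every family (I_u)_{u ∈ S} of maps I_u : Σ → S such that for each σ ∈ Σ the assignment u ↦ I_u(σ) is a bijection from S to S, one has ∏_{u ∈ S} P(I_u) = p. Then P factorizes through the places: there exist maps P_σ : S → Z for each σ ∈ Σ such that P(I) = ∏_{σ ∈ Σ} P_σ(I(σ)) for every map I : Σ → S. -/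
/-- Given two pairs of distinct points, some permutation maps the first pair to the second. -/
lemma exists_perm_apply_eq_pair {S : Type*} {u v a b : S} (huv : u ≠ v) (hab : a ≠ b) :
    ∃ e : Equiv.Perm S, e u = a ∧ e v = b := by
  classical
  refine ⟨(Equiv.swap u a).trans (Equiv.swap (Equiv.swap u a v) b), ?_, by simp⟩
  have h : a ≠ Equiv.swap u a v := fun h => huv <| (Equiv.swap u a).injective (by simpa using h)
  simpa using Equiv.swap_apply_of_ne_of_ne h hab

open Function in
/-- Exchanging the values at one place of two everywhere distinct maps preserves the product
of their periods. -/
lemma mul_eq_mul_update_of_forall_ne {A S Z : Type*} [DecidableEq A] [Fintype S]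
    [CommGroup Z] {P : (A → S) → Z} {p : Z}
    (hP : ∀ I : S → A → S, (∀ σ, Bijective fun u => I u σ) → ∏ u, P (I u) = p)
    {I J : A → S} (hIJ : ∀ τ, I τ ≠ J τ) (σ : A) :
    P I * P J = P (update I σ (J σ)) * P (update J σ (I σ)) := by
  classical
  have huv := hIJ σ
  generalize hu : I σ = u at huv
  generalize hv : J σ = v at huv
  choose e heu hev using fun τ => exists_perm_apply_eq_pair huv (hIJ τ)
  let F : S → A → S := fun w τ => e τ w
  let G : S → A → S := fun w => update (F w) σ (e σ (Equiv.swap u v w))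
  have hF : ∏ w, P (F w) = p := hP F fun τ => (e τ).bijective
  have hG : ∏ w, P (G w) = p := hP G fun τ => by
    by_cases h : τ = σ
    · subst h
      simpa [G] using ((Equiv.swap u v).trans (e τ)).bijective
    · simp [G, F, h]
  have hquot : ∏ w, P (F w) / P (G w) = 1 := by
    rw [Finset.prod_div_distrib, hF, hG, div_self']
  rw [Fintype.prod_eq_mul u v huv] at hquot
  · have hFu : F u = I := funext heu
    have hFv : F v = J := funext hev
    have hGu : G u = update I σ v := by simp [G, hFu, hev, hv]
    have hGv : G v = update J σ u := by simp [G, hFv, heu, hu]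
    rw [hFu, hFv, hGu, hGv, div_mul_div_comm, div_eq_one] at hquot
    exact hquot
  · rintro w ⟨hwu, hwv⟩
    have : G w = F w := by simp [G, F, Equiv.swap_apply_of_ne_of_ne hwu hwv]
    rw [this, div_self']

open Function in
/-- The effect on `P` of changing the value at one place does not depend on the other places. -/
lemma div_update_eq_div_update {A S Z : Type*} [DecidableEq A] [Fintype S]
    (hS : 3 ≤ Fintype.card S) [CommGroup Z] {P : (A → S) → Z} {p : Z}
    (hP : ∀ I : S → A → S, (∀ σ, Bijective fun u => I u σ) → ∏ u, P (I u) = p)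
    (I J : A → S) (σ : A) (a b : S) :
    P (update I σ a) / P (update I σ b) = P (update J σ a) / P (update J σ b) := by
  classical
  rcases eq_or_ne a b with rfl | hab
  · simp
  have hthird (τ : A) : ∃ s, s ≠ I τ ∧ s ≠ J τ := by
    obtain ⟨s, hs⟩ := Finset.exists_mem_notMem_of_card_lt_card
      (s := {I τ, J τ}) (t := Finset.univ)
      (Finset.card_le_two.trans_lt (by rw [Finset.card_univ]; omega))
    exact ⟨s, by simpa using hs⟩
  choose K hKI hKJ using hthird
  have key (L : A → S) (hL : ∀ τ, K τ ≠ L τ) :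
      P (update L σ a) / P (update L σ b) = P (update K σ a) / P (update K σ b) := by
    have h := mul_eq_mul_update_of_forall_ne hP (I := update L σ a) (J := update K σ b)
      (fun τ => by
        by_cases h : τ = σ
        · subst h; simpa using hab
        · simpa [h] using (hL τ).symm) σ
    simp only [update_self, update_idem] at h
    rw [div_eq_div_iff_mul_eq_mul, h, mul_comm]
  rw [key I hKI, key J hKJ]

/-- Let `A` be a nonempty finite set of places, `S` a finite set of
signatures with at least 3 elements, and `Z` a commutative group. Suppose
`P : (A → S) → Z` has the property that there is a `p ∈ Z` such that for every family
`(I u)_{u ∈ S}` of maps `A → S` for which `u ↦ I u σ` is a bijection of `S` for each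
place `σ`, one has `∏ u, P (I u) = p`. Then `P` factorizes through the places. -/
theorem periods_factorize_through_places {A S Z : Type*} [Fintype A] [Nonempty A]
    [Fintype S] (hS : 3 ≤ Fintype.card S) [CommGroup Z]
    (P : (A → S) → Z)
    (hP : ∃ p : Z, ∀ I : S → A → S,
      (∀ σ : A, Function.Bijective fun u : S => I u σ) → ∏ u : S, P (I u) = p) :
    ∃ Q : A → S → Z, ∀ I : A → S, P I = ∏ σ : A, Q σ (I σ) := by
  classical
  obtain ⟨p, hP⟩ := hP
  have : Nonempty S := Fintype.card_pos_iff.mp (by omega)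
  obtain ⟨c⟩ := this
  obtain ⟨σ₀⟩ := ‹Nonempty A›
  let C : A → S := fun _ => c
  let D : A → S → Z := fun σ s => P (Function.update C σ s) / P C
  have hD (I : A → S) (T : Finset A) :
      P (T.piecewise I C) = P C * ∏ σ ∈ T, D σ (I σ) := by
    induction T using Finset.induction_on with
    | empty => simp
    | insert σ T hσ ih =>
      have h := div_update_eq_div_update hS hP (T.piecewise I C) C σ (I σ) c
      have h₁ : Function.update (T.piecewise I C) σ c = T.piecewise I C := by
        simp [Function.update_eq_self_iff, hσ, C]
      have h₂ : Function.update C σ c = C := by simp [C]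
      rw [h₁, h₂, div_eq_iff_eq_mul] at h
      rw [Finset.piecewise_insert, h, ih, Finset.prod_insert hσ, mul_left_comm]
  refine ⟨fun σ s => (if σ = σ₀ then P C else 1) * D σ s, fun I => ?_⟩
  rw [Finset.prod_mul_distrib, Finset.prod_ite_eq' Finset.univ σ₀ fun _ => P C]
  simpa using hD I Finset.univ
end

section
/- Fix integers r, s ≥ 0 and n = r + s, and let λ : {1,…,n} → ℤ be weakly decreasing, i.e. λ(1) ≥ λ(2) ≥ ⋯ ≥ λ(n). For a block-increasing permutation w of {1,…,n} set T(w) = Σ_{i=1}^{r} (λ(w(i)) − w(i) + i), and let w₀ be the block-increasing permutation with w₀(i) = s + i for 1 ≤ i ≤ r and w₀(r+j) = j for 1 ≤ j ≤ s. Then for every block-increasing permutation w one has T(w) ≥ T(w₀), with equality if and only if w = w₀. (Consequently the Hodge number p(w,λ), which equals a constant minus T(w), attains its maximum over W¹ uniquely at w₀.) -/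
/-- A permutation of `Fin n` is block-increasing (for block sizes `r` and `n - r`)
if it is strictly increasing on the first `r` indices and strictly increasing on the
remaining indices. -/
def IsBlockIncreasing (r : ℕ) {n : ℕ} (w : Equiv.Perm (Fin n)) : Prop :=
  (∀ i j : Fin n, i < j → (j : ℕ) < r → w i < w j) ∧
  (∀ i j : Fin n, i < j → r ≤ (i : ℕ) → w i < w j)

/-- `Tsum r lam w = Σ_{i < r} (λ(w i) − w i + i)`, the quantity entering the Hodge
number `p(w, λ)`. -/
def Tsum (r : ℕ) {n : ℕ} (lam : Fin n → ℤ) (w : Equiv.Perm (Fin n)) : ℤ :=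
  ∑ i ∈ Finset.univ.filter (fun i : Fin n => (i : ℕ) < r),
    (lam (w i) - ((w i : ℕ) : ℤ) + ((i : ℕ) : ℤ))

/-- A map into `ℕ` which is strictly increasing on the indices in `[a, b)` grows at least as
fast as the index there. -/
theorem add_sub_le_of_strictMono_on_block {n : ℕ} (f : Fin n → ℕ) (a b : ℕ)
    (hf : ∀ i j : Fin n, i < j → a ≤ (i : ℕ) → (j : ℕ) < b → f i < f j)
    (i j : Fin n) (hij : i ≤ j) (hi : a ≤ (i : ℕ)) (hj : (j : ℕ) < b) :
    f i + ((j : ℕ) - i) ≤ f j := by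
  obtain ⟨j, hjn⟩ := j
  induction j with
  | zero =>
    have h : i = ⟨0, hjn⟩ := le_antisymm hij (Nat.zero_le _)
    simp [h]
  | succ k ih =>
    rcases hij.eq_or_lt with h | h
    · simp [h]
    · have hik : (i : ℕ) ≤ k := Nat.lt_succ_iff.mp h
      have h₁ := ih (Nat.lt_of_succ_lt hjn) hik (Nat.lt_of_succ_lt hj)
      have h₂ := hf ⟨k, Nat.lt_of_succ_lt hjn⟩ ⟨k + 1, hjn⟩ (Nat.lt_succ_self k) (hi.trans hik) hj
      simp only at h₁ ⊢
      omega

/-- The first block of a block-increasing permutation lies below the shift by `s`. -/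
theorem IsBlockIncreasing.apply_le {r s n : ℕ} (hn : n = r + s) {w : Equiv.Perm (Fin n)}
    (hw : IsBlockIncreasing r w) (i : Fin n) (hi : (i : ℕ) < r) : (w i : ℕ) ≤ s + i := by
  have h := add_sub_le_of_strictMono_on_block (fun k => (w k : ℕ)) 0 r
    (fun i j hij _ hj => hw.1 i j hij hj) i ⟨r - 1, by omega⟩
    (Fin.le_def.mpr (by simp only; omega)) (Nat.zero_le _) (by simp only; omega)
  have h' := (w ⟨r - 1, by omega⟩).isLt
  simp only at h
  omega

/-- A block-increasing permutation is determined by its first block when that block consists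
of the `r` largest values. -/
theorem IsBlockIncreasing.apply_eq_sub {r s n : ℕ} (hn : n = r + s) {w : Equiv.Perm (Fin n)}
    (hw : IsBlockIncreasing r w) (h_first : ∀ i : Fin n, (i : ℕ) < r → (w i : ℕ) = s + i)
    (i : Fin n) (hi : r ≤ (i : ℕ)) : (w i : ℕ) = i - r := by
  have h_lt : ∀ j : Fin n, r ≤ (j : ℕ) → (w j : ℕ) < s := by
    intro j hj
    by_contra! h
    have hlt := (w j).isLt
    have hk := h_first ⟨(w j : ℕ) - s, by omega⟩ (by simp only; omega)
    have heq : w ⟨(w j : ℕ) - s, by omega⟩ = w j := Fin.ext (by simp only at hk; omega)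
    have := congrArg Fin.val (w.injective heq)
    simp only at this
    omega
  have hin := i.isLt
  have hmono : ∀ i j : Fin n, i < j → r ≤ (i : ℕ) → (j : ℕ) < n → (w i : ℕ) < w j :=
    fun i j hij hi _ => hw.2 i j hij hi
  have h₁ := add_sub_le_of_strictMono_on_block (fun k => (w k : ℕ)) r n hmono
    ⟨r, by omega⟩ i hi le_rfl hin
  have h₂ := add_sub_le_of_strictMono_on_block (fun k => (w k : ℕ)) r n hmono
    i ⟨n - 1, by omega⟩ (Fin.le_def.mpr (by simp only; omega)) hi (by simp only; omega)
  have h₃ := h_lt ⟨n - 1, by omega⟩ (by simp only; omega)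
  simp only at h₁ h₂
  omega

/-- Fix `r, s ≥ 0`, `n = r + s`, and a weakly decreasing
`λ : Fin n → ℤ`. Let `w₀` be the block-increasing permutation with `w₀ i = s + i` on
the first block and `w₀ (r + j) = j` on the second block. Then every block-increasing
permutation `w` satisfies `Tsum r λ w ≥ Tsum r λ w₀`, with equality iff `w = w₀`. -/
theorem Tsum_minimized_at_longest_element (r s n : ℕ) (hn : n = r + s)
    (lam : Fin n → ℤ) (hlam : ∀ i j : Fin n, i ≤ j → lam j ≤ lam i)
    (w₀ : Equiv.Perm (Fin n))
    (hw₀₁ : ∀ i : Fin n, (i : ℕ) < r → (w₀ i : ℕ) = s + (i : ℕ))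
    (hw₀₂ : ∀ i : Fin n, r ≤ (i : ℕ) → (w₀ i : ℕ) = (i : ℕ) - r) :
    ∀ w : Equiv.Perm (Fin n), IsBlockIncreasing r w →
      Tsum r lam w₀ ≤ Tsum r lam w ∧ (Tsum r lam w = Tsum r lam w₀ ↔ w = w₀) := by
  intro w hw
  have h_le : ∀ i : Fin n, (i : ℕ) < r → w i ≤ w₀ i := fun i hi =>
    Fin.le_def.mpr (by rw [hw₀₁ i hi]; exact hw.apply_le hn i hi)
  have h_term : ∀ i ∈ Finset.univ.filter (fun i : Fin n => (i : ℕ) < r),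
      lam (w₀ i) - ((w₀ i : ℕ) : ℤ) + ((i : ℕ) : ℤ) ≤
        lam (w i) - ((w i : ℕ) : ℤ) + ((i : ℕ) : ℤ) := by
    intro i hi
    have h₁ := h_le i (Finset.mem_filter.mp hi).2
    have h₂ := hlam _ _ h₁
    have h₃ := Fin.le_def.mp h₁
    omega
  refine ⟨Finset.sum_le_sum h_term, fun h_eq => ?_, fun h => by rw [h]⟩
  have h_first : ∀ i : Fin n, (i : ℕ) < r → (w i : ℕ) = s + i := by
    intro i hi
    have h := (Finset.sum_eq_sum_iff_of_le h_term).mp h_eq.symm i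
      (Finset.mem_filter.mpr ⟨Finset.mem_univ i, hi⟩)
    have h₂ := hlam _ _ (h_le i hi)
    have h₃ := Fin.le_def.mp (h_le i hi)
    have h₄ := hw₀₁ i hi
    omega
  ext i
  rcases lt_or_ge (i : ℕ) r with hi | hi
  · rw [h_first i hi, hw₀₁ i hi]
  · rw [hw.apply_eq_sub hn h_first i hi, hw₀₂ i hi]
end

section
/- Let n ≥ 1. Let a : {1,…,n} → ℝ be strictly decreasing, and let k₁, k₂ ∈ ℝ with k₁ ≠ k₂ and with −k₁, −k₂ not in the image of a. Let b : {1,…,n+2} → ℝ be the strictly decreasing enumeration of the set {a(1),…,a(n)} ∪ {−k₁, −k₂}, and let c : {1,…,n+3} → ℝ satisfy the strict interlacing −c(n+3) > b(1) > −c(n+2) > b(2) > ⋯ > −c(2) > b(n+2) > −c(1). Define I⋄₁ := #{i ∈ {1,…,n+3} : −c(i) > −k₁}, I⋄₂ := #{i ∈ {1,…,n+3} : −c(i) > −k₂}, I₁ := #{i ∈ {1,…,n} : −a(i) > k₁}, I₂ := #{i ∈ {1,…,n} : −a(i) > k₂}, and t := 1 if k₁ < k₂ and t := −1 if k₁ >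 k₂. Then −2·I⋄₁ + (n+3) = 2·I₁ − n + t and −2·I⋄₂ + (n+3) = 2·I₂ − n − t. -/
/-- A strictly decreasing sequence `c` whose negatives interlace `b` has exactly `p + 1` entries
with `b p < -c i`. -/
theorem card_filter_lt_neg_of_interlacing {m : ℕ} {b : Fin (m + 1) → ℝ} {c : Fin (m + 2) → ℝ}
    (hcb : ∀ i : Fin (m + 1), b i < -c ⟨m + 1 - (i : ℕ), by omega⟩)
    (hbc : ∀ i : Fin (m + 1), -c ⟨m - (i : ℕ), by omega⟩ < b i) (p : Fin (m + 1)) :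
    (Finset.univ.filter fun i : Fin (m + 2) => b p < -c i).card = p + 1 := by
  have hc : StrictAnti c := by
    refine Fin.strictAnti_iff_succ_lt.2 fun i => ?_
    have h := (hbc i.rev).trans (hcb i.rev)
    have h₁ : (⟨m - (i.rev : ℕ), by omega⟩ : Fin (m + 2)) = i.castSucc := by
      ext; simp [Fin.val_rev]; omega
    have h₂ : (⟨m + 1 - (i.rev : ℕ), by omega⟩ : Fin (m + 2)) = i.succ := by
      ext; simp [Fin.val_rev]; omega
    rw [h₁, h₂] at h
    exact neg_lt_neg_iff.1 h
  have hset : (Finset.univ.filter fun i : Fin (m + 2) => b p < -c i) =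
      Finset.Ici ⟨m + 1 - (p : ℕ), by omega⟩ := by
    ext i
    simp only [Finset.mem_filter, Finset.mem_univ, true_and, Finset.mem_Ici]
    constructor
    · intro h
      by_contra! hi
      rw [Fin.lt_def] at hi
      have hle : i ≤ ⟨m - (p : ℕ), by omega⟩ := by rw [Fin.le_def]; dsimp only at hi ⊢; omega
      linarith [hc.antitone hle, hbc p]
    · intro h
      linarith [hc.antitone h, hcb p]
  rw [hset, Fin.card_Ici]
  have := p.isLt
  dsimp only
  omega

theorem card_filter_image_lt {ι : Type*} [Fintype ι] {f : ι → ℝ} (hf : Function.Injective f)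
    (x : ℝ) :
    ((Finset.univ.image f).filter (· < x)).card = (Finset.univ.filter fun i => f i < x).card := by
  rw [Finset.filter_image, Finset.card_image_of_injective _ hf]

/-- Adjoining the two new values `x ≠ y` to `a` and sorting the result as `b`, the entries of `b`
below `x` are those of `a`, together with `y` when `y < x`. -/
theorem card_filter_lt_of_range_eq_union_pair {n m : ℕ} {a : Fin n → ℝ} {b : Fin m → ℝ}
    (ha : Function.Injective a) (hb : Function.Injective b) {x y : ℝ} (hy : y ∉ Set.range a)
    (hbr : Set.range b = Set.range a ∪ {x, y}) :
    (Finset.univ.filter fun i => b i < x).card =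
      (Finset.univ.filter fun i => a i < x).card + if y < x then 1 else 0 := by
  have himage : Finset.univ.image b = Finset.univ.image a ∪ {x, y} := by
    apply Finset.coe_injective
    simpa using hbr
  have hy' : y ∉ (Finset.univ.image a).filter (· < x) := by
    simp only [Finset.mem_filter, Finset.mem_image, Finset.mem_univ, true_and]
    exact fun h => hy h.1
  rw [← card_filter_image_lt hb, ← card_filter_image_lt ha, himage, Finset.filter_union,
    Finset.filter_insert, Finset.filter_singleton]
  split_ifs with hx hyx
  · exact absurd hx (lt_irrefl x)
  · exact absurd hx (lt_irrefl x)
  · rw [Finset.union_comm, Finset.singleton_union, Finset.card_insert_of_notMem hy']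
  · simp

/-- The position in `b` of the adjoined value `-k`, in terms of the entries of `a` below it. -/
theorem exists_eq_neg_and_add_card {n : ℕ} {a : Fin n → ℝ} (ha : StrictAnti a) {k l : ℝ}
    (hl : -l ∉ Set.range a) {b : Fin (n + 2) → ℝ} (hb : StrictAnti b)
    (hbr : Set.range b = Set.range a ∪ {-k, -l}) :
    ∃ p : Fin (n + 2), b p = -k ∧
      (p : ℕ) + ((Finset.univ.filter fun i : Fin n => k < -a i).card + if k < l then 1 else 0) =
        n + 1 := by
  obtain ⟨p, hp⟩ : -k ∈ Set.range b := hbr ▸ by simp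
  refine ⟨p, hp, ?_⟩
  have hIoi : (Finset.univ.filter fun i => b i < -k) = Finset.Ioi p := by
    ext i
    simp [← hp, hb.lt_iff_gt]
  have hcard := card_filter_lt_of_range_eq_union_pair ha.injective hb.injective hl hbr
  rw [hIoi, Fin.card_Ioi] at hcard
  simp only [neg_lt_neg_iff] at hcard
  simp only [lt_neg (a := k)]
  rw [← hcard]
  omega

/-- Let `n ≥ 1`, `a : Fin n → ℝ` strictly decreasing, `k₁ ≠ k₂`
with `−k₁, −k₂` outside the range of `a`. Let `b : Fin (n+2) → ℝ` be the strictly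
decreasing enumeration of `range a ∪ {−k₁, −k₂}` and let `c : Fin (n+3) → ℝ` strictly
interlace `b`, i.e. `−c(n+3) > b(1) > −c(n+2) > b(2) > ⋯ > −c(2) > b(n+2) > −c(1)`
(written here with zero-based indexing). With
`I⋄ᵤ = #{i : −c i > −kᵤ}`, `Iᵤ = #{i : −a i > kᵤ}` and `t = ±1` according to
`k₁ < k₂` or `k₁ > k₂`, one has `−2 I⋄₁ + (n+3) = 2 I₁ − n + t` and
`−2 I⋄₂ + (n+3) = 2 I₂ − n − t`. -/
theorem interlacing_signature_identity (n : ℕ) (hn : 1 ≤ n)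
    (a : Fin n → ℝ) (ha : StrictAnti a)
    (k₁ k₂ : ℝ) (hk : k₁ ≠ k₂)
    (hk₁ : -k₁ ∉ Set.range a) (hk₂ : -k₂ ∉ Set.range a)
    (b : Fin (n + 2) → ℝ) (hb : StrictAnti b)
    (hbr : Set.range b = Set.range a ∪ {-k₁, -k₂})
    (c : Fin (n + 3) → ℝ)
    (hcb : ∀ i : Fin (n + 2), b i < -c ⟨n + 2 - (i : ℕ), by omega⟩)
    (hbc : ∀ i : Fin (n + 2), -c ⟨n + 1 - (i : ℕ), by omega⟩ < b i)
    (I₁ I₂ Id₁ Id₂ : ℕ)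
    (hI₁ : I₁ = (Finset.univ.filter fun i : Fin n => k₁ < -a i).card)
    (hI₂ : I₂ = (Finset.univ.filter fun i : Fin n => k₂ < -a i).card)
    (hId₁ : Id₁ = (Finset.univ.filter fun i : Fin (n + 3) => -k₁ < -c i).card)
    (hId₂ : Id₂ = (Finset.univ.filter fun i : Fin (n + 3) => -k₂ < -c i).card)
    (t : ℤ) (ht : t = if k₁ < k₂ then 1 else -1) :
    -2 * (Id₁ : ℤ) + ((n : ℤ) + 3) = 2 * (I₁ : ℤ) - (n : ℤ) + t ∧
    -2 * (Id₂ : ℤ) + ((n : ℤ) + 3) = 2 * (I₂ : ℤ) - (n : ℤ) - t := by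
  obtain ⟨p, hp, h₁⟩ := exists_eq_neg_and_add_card ha hk₂ hb hbr
  obtain ⟨q, hq, h₂⟩ := exists_eq_neg_and_add_card ha hk₁ hb (Set.pair_comm (-k₁) (-k₂) ▸ hbr)
  rw [← hI₁] at h₁
  rw [← hI₂] at h₂
  rw [← hp, card_filter_lt_neg_of_interlacing hcb hbc] at hId₁
  rw [← hq, card_filter_lt_neg_of_interlacing hcb hbc] at hId₂
  rcases hk.lt_or_gt with h | h
  · rw [if_pos h] at h₁ ht
    rw [if_neg h.not_gt] at h₂
    omega
  · rw [if_neg h.not_gt] at h₁ ht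
    rw [if_pos h] at h₂
    omega
end
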